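/- arXiv:1203.4553 — 2 statements merged into one kernel-verified Lean document; each statement's English description precedes it below -/
import Mathlib

section
/- Suppose α is an isophote with axis d and angle θ, and suppose k_n(s)² + τ_g(s)² > 0 for all s. Then for every s: k_n(s)·⟪T(s), d⟫ + τ_g(s)·⟪B(s), d⟫ = 0, (k_n(s)² + τ_g(s)²)·⟪T(s), d⟫² = τ_g(s)²·sin²θ, and (k_n(s)² + τ_g(s)²)·⟪B(s), d⟫² = k_n(s)²·sin²θ. -/
open scoped RealInnerProductSpace

noncomputable section

/-- The cross product on `EuclideanSpace ℝ (Fin 3)`. -/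
def cross3 (u v : EuclideanSpace ℝ (Fin 3)) : EuclideanSpace ℝ (Fin 3) :=
  (EuclideanSpace.equiv (Fin 3) ℝ).symm
    (crossProduct ((EuclideanSpace.equiv (Fin 3) ℝ) u) ((EuclideanSpace.equiv (Fin 3) ℝ) v))

lemma cross3_ofLp (u v : EuclideanSpace ℝ (Fin 3)) :
    (cross3 u v).ofLp = crossProduct u.ofLp v.ofLp := rfl

lemma real_inner_eq_sum_three (u v : EuclideanSpace ℝ (Fin 3)) :
    ⟪u, v⟫ = u 0 * v 0 + u 1 * v 1 + u 2 * v 2 := by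
  simp [PiLp.inner_apply, Fin.sum_univ_three, mul_comm]

lemma inner_left_cross3 (u v : EuclideanSpace ℝ (Fin 3)) : ⟪u, cross3 u v⟫ = 0 := by
  rw [real_inner_eq_sum_three, cross3_ofLp, cross_apply]
  simp only [Matrix.cons_val]
  ring

lemma inner_right_cross3 (u v : EuclideanSpace ℝ (Fin 3)) : ⟪v, cross3 u v⟫ = 0 := by
  rw [real_inner_eq_sum_three, cross3_ofLp, cross_apply]
  simp only [Matrix.cons_val]
  ring

lemma inner_cross3_self (u v : EuclideanSpace ℝ (Fin 3)) :
    ⟪cross3 u v, cross3 u v⟫ = ⟪u, u⟫ * ⟪v, v⟫ - ⟪u, v⟫ ^ 2 := by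
  simp only [real_inner_eq_sum_three, cross3_ofLp, cross_apply, Matrix.cons_val]
  ring

/-- Parseval's identity in the orthonormal frame `u`, `v`, `u × v`. -/
lemma inner_eq_of_orthonormal_cross3 {u v : EuclideanSpace ℝ (Fin 3)} (hu : ‖u‖ = 1)
    (hv : ‖v‖ = 1) (huv : ⟪u, v⟫ = 0) (x y : EuclideanSpace ℝ (Fin 3)) :
    ⟪x, y⟫ = ⟪x, u⟫ * ⟪u, y⟫ + ⟪x, v⟫ * ⟪v, y⟫ + ⟪x, cross3 u v⟫ * ⟪cross3 u v, y⟫ := by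
  have hw : ‖cross3 u v‖ = 1 := by
    have h := inner_cross3_self u v
    rw [huv, real_inner_self_eq_norm_sq, real_inner_self_eq_norm_sq, real_inner_self_eq_norm_sq,
      hu, hv] at h
    nlinarith [norm_nonneg (cross3 u v)]
  have hon : Orthonormal ℝ ![u, v, cross3 u v] := by
    have h1 := inner_left_cross3 u v
    have h2 := inner_right_cross3 u v
    refine ⟨fun i => by fin_cases i <;> simp [hu, hv, hw], fun i j hij => ?_⟩
    fin_cases i <;> fin_cases j <;> first
      | exact absurd rfl hij
      | simpa using huv
      | simpa using h1
      | simpa using h2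
      | simpa [real_inner_comm] using huv
      | simpa [real_inner_comm] using h1
      | simpa [real_inner_comm] using h2
  let b := basisOfOrthonormalOfCardEqFinrank hon (by simp)
  have hb : ⇑b = ![u, v, cross3 u v] := coe_basisOfOrthonormalOfCardEqFinrank hon (by simp)
  have h := (b.toOrthonormalBasis (hb ▸ hon)).sum_inner_mul_inner x y
  simpa [Fin.sum_univ_three, hb] using h.symm

lemma Differentiable.cross3 {f g : ℝ → EuclideanSpace ℝ (Fin 3)} (hf : Differentiable ℝ f)
    (hg : Differentiable ℝ g) : Differentiable ℝ fun s => cross3 (f s) (g s) := by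
  rw [differentiable_euclidean] at hf hg ⊢
  intro i
  fin_cases i <;>
  · simp only [cross3_ofLp, cross_apply, Fin.zero_eta, Fin.mk_one, Fin.reduceFinMk,
      Matrix.cons_val]
    exact ((hf _).mul (hg _)).sub ((hf _).mul (hg _))

/-- If `f` and `g` have constant inner product, then `⟪f', g⟫ = -⟪g', f⟫`. -/
lemma inner_deriv_eq_neg_of_inner_const {E : Type*} [NormedAddCommGroup E]
    [InnerProductSpace ℝ E] {f g : ℝ → E} (hf : Differentiable ℝ f) (hg : Differentiable ℝ g)
    {c : ℝ} (h : ∀ s, ⟪f s, g s⟫ = c) (s : ℝ) : ⟪deriv f s, g s⟫ = -⟪deriv g s, f s⟫ := by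
  have h1 := (hf s).hasDerivAt.inner ℝ (hg s).hasDerivAt
  simp only [h] at h1
  have h2 := h1.unique (hasDerivAt_const s c)
  rw [real_inner_comm] at h2
  linarith

theorem stmt0
    (α N : ℝ → EuclideanSpace ℝ (Fin 3))
    (hα : ContDiff ℝ (⊤ : ℕ∞) α) (hN : ContDiff ℝ (⊤ : ℕ∞) N)
    (hunit : ∀ s, ‖deriv α s‖ = 1)
    (hNunit : ∀ s, ‖N s‖ = 1)
    (hNT : ∀ s, ⟪N s, deriv α s⟫ = 0)
    (T B : ℝ → EuclideanSpace ℝ (Fin 3))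
    (hT : ∀ s, T s = deriv α s)
    (hB : ∀ s, B s = cross3 (N s) (T s))
    (kn kg τg : ℝ → ℝ)
    (hkn : ∀ s, kn s = ⟪deriv T s, N s⟫)
    (hkg : ∀ s, kg s = ⟪deriv T s, B s⟫)
    (hτg : ∀ s, τg s = ⟪deriv B s, N s⟫)
    (d : EuclideanSpace ℝ (Fin 3)) (hd : ‖d‖ = 1) (θ : ℝ)
    (hiso : ∀ s, ⟪N s, d⟫ = Real.cos θ)
    (hpos : ∀ s, 0 < kn s ^ 2 + τg s ^ 2) :
    ∀ s, kn s * ⟪T s, d⟫ + τg s * ⟪B s, d⟫ = 0 ∧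
      (kn s ^ 2 + τg s ^ 2) * ⟪T s, d⟫ ^ 2 = τg s ^ 2 * Real.sin θ ^ 2 ∧
      (kn s ^ 2 + τg s ^ 2) * ⟪B s, d⟫ ^ 2 = kn s ^ 2 * Real.sin θ ^ 2 := by
  intro s
  have hNd : Differentiable ℝ N := hN.differentiable (by simp)
  have hTd : Differentiable ℝ T := by
    rw [funext hT]
    exact ((contDiff_infty_iff_deriv.mp hα).2).differentiable (by simp)
  have hBd : Differentiable ℝ B := by
    rw [funext hB]
    exact hNd.cross3 hTd
  have hNT' (s) : ⟪N s, T s⟫ = 0 := by rw [hT, hNT]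
  have hNB (s) : ⟪N s, B s⟫ = 0 := by rw [hB, inner_left_cross3]
  have hN'N : ⟪deriv N s, N s⟫ = 0 := by
    have h := inner_deriv_eq_neg_of_inner_const hNd hNd (c := 1)
      (fun s => by rw [real_inner_self_eq_norm_sq, hNunit, one_pow]) s
    linarith
  have hN'T : ⟪deriv N s, T s⟫ = -kn s := by
    rw [inner_deriv_eq_neg_of_inner_const hNd hTd hNT' s, hkn]
  have hN'B : ⟪deriv N s, B s⟫ = -τg s := by
    rw [inner_deriv_eq_neg_of_inner_const hNd hBd hNB s, hτg]
  have hN'd : ⟪deriv N s, d⟫ = 0 := by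
    rw [inner_deriv_eq_neg_of_inner_const hNd (differentiable_const d) hiso s]
    simp
  have parseval := inner_eq_of_orthonormal_cross3 (hNunit s) (by rw [hT, hunit]) (hNT' s)
  simp only [← hB] at parseval
  have h0 : kn s * ⟪T s, d⟫ + τg s * ⟪B s, d⟫ = 0 := by
    have h := parseval (deriv N s) d
    rw [hN'N, hN'T, hN'B, hN'd] at h
    linarith
  have h1 : ⟪T s, d⟫ ^ 2 + ⟪B s, d⟫ ^ 2 = Real.sin θ ^ 2 := by
    have h := parseval d d
    rw [real_inner_self_eq_norm_sq, hd, real_inner_comm (N s) d, real_inner_comm (T s) d,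
      real_inner_comm (B s) d, hiso] at h
    linarith [Real.sin_sq_add_cos_sq θ]
  refine ⟨h0, ?_, ?_⟩
  · rw [← h1]
    linear_combination (kn s * ⟪T s, d⟫ - τg s * ⟪B s, d⟫) * h0
  · rw [← h1]
    linear_combination (τg s * ⟪B s, d⟫ - kn s * ⟪T s, d⟫) * h0
end
end

section
/- Let d be a unit vector such that the function s ↦ ⟪C'(s), d⟫ is constant (C is a general helix with axis d). Then for every integer k, the function s ↦ ⟪K(s, (2k+1)π/2) − C(s), d⟫ is constant; i.e. the v₀ = (2k+1)π/2 parameter curves of the tube are isophotes with axis d. -/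
open scoped RealInnerProductSpace

noncomputable section

/-- The square of the scalar triple product is the Gram determinant. -/
theorem inner_cross3_sq (u v d : EuclideanSpace ℝ (Fin 3)) :
    ⟪cross3 u v, d⟫ ^ 2 =
      ⟪u, u⟫ * ⟪v, v⟫ * ⟪d, d⟫ + 2 * ⟪u, v⟫ * ⟪u, d⟫ * ⟪v, d⟫
        - ⟪u, u⟫ * ⟪v, d⟫ ^ 2 - ⟪v, v⟫ * ⟪u, d⟫ ^ 2 - ⟪d, d⟫ * ⟪u, v⟫ ^ 2 := by
  simp only [cross3, PiLp.inner_apply, Fin.sum_univ_three, RCLike.inner_apply, conj_trivial,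
    EuclideanSpace.equiv, PiLp.coe_symm_continuousLinearEquiv, PiLp.coe_continuousLinearEquiv,
    cross_apply, Matrix.cons_val_zero, Matrix.cons_val_one, Matrix.cons_val]
  ring

theorem continuous_cross3 {f g : ℝ → EuclideanSpace ℝ (Fin 3)} (hf : Continuous f)
    (hg : Continuous g) : Continuous fun s => cross3 (f s) (g s) := by
  unfold cross3
  refine (EuclideanSpace.equiv (Fin 3) ℝ).symm.continuous.comp ?_
  simp only [cross_apply, EuclideanSpace.equiv, PiLp.coe_continuousLinearEquiv]
  refine continuous_pi fun i => ?_
  fin_cases i <;> simp <;> fun_prop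

/-- A continuous real function on the line whose square is constant is itself constant. -/
theorem Continuous.eq_of_sq_eq_const {f : ℝ → ℝ} (hf : Continuous f) {a : ℝ}
    (h : ∀ s, f s ^ 2 = a) (s t : ℝ) : f s = f t := by
  by_cases ha : a = 0
  · have hz : ∀ x, f x = 0 := fun x => by simpa [ha] using h x
    rw [hz s, hz t]
  · have ht : f t ≠ 0 := fun h0 => ha (by simp [← h t, h0])
    rcases isPreconnected_univ.eq_or_eq_neg_of_sq_eq (f := f) (g := fun _ => f t)
      hf.continuousOn continuousOn_const (fun x _ => by simp [h x, h t]) (fun _ => ht)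
      with H | H
    · exact H (Set.mem_univ s)
    · have := H (Set.mem_univ t)
      simp only [Pi.neg_apply] at this
      exact absurd (by linarith) ht

theorem stmt13
    (C : ℝ → EuclideanSpace ℝ (Fin 3)) (hC : ContDiff ℝ (⊤ : ℕ∞) C)
    (hunit : ∀ s, ‖deriv C s‖ = 1)
    (κ : ℝ → ℝ) (hκ : ∀ s, κ s = ‖deriv (deriv C) s‖) (hκpos : ∀ s, 0 < κ s)
    (n b : ℝ → EuclideanSpace ℝ (Fin 3))
    (hn : ∀ s, n s = (κ s)⁻¹ • deriv (deriv C) s)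
    (hb : ∀ s, b s = cross3 (deriv C s) (n s))
    (r : ℝ) (hr : 0 < r)
    (K : ℝ → ℝ → EuclideanSpace ℝ (Fin 3))
    (hK : ∀ s v, K s v = C s + r • (Real.cos v • n s + Real.sin v • b s))
    (d : EuclideanSpace ℝ (Fin 3)) (hd : ‖d‖ = 1)
    (hhelix : ∀ s t : ℝ, ⟪deriv C s, d⟫ = ⟪deriv C t, d⟫) :
    ∀ k : ℤ, ∀ s t : ℝ,
      ⟪K s ((2 * (k : ℝ) + 1) * Real.pi / 2) - C s, d⟫ =
        ⟪K t ((2 * (k : ℝ) + 1) * Real.pi / 2) - C t, d⟫ := by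
  intro k s t
  have hT : ContDiff ℝ (⊤ : ℕ∞) (deriv C) := (contDiff_infty_iff_deriv.mp hC).2
  have hT' : Continuous (deriv (deriv C)) := (contDiff_infty_iff_deriv.mp hT).2.continuous
  have hTd : ∀ x, HasDerivAt (deriv C) (deriv (deriv C) x) x := fun x =>
    ((contDiff_infty_iff_deriv.mp hT).1 x).hasDerivAt
  have hTT : ∀ x, ⟪deriv C x, deriv C x⟫ = 1 := fun x => by
    rw [real_inner_self_eq_norm_sq, hunit, one_pow]
  have hT'T : ∀ x, ⟪deriv C x, deriv (deriv C) x⟫ = 0 := fun x => by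
    have h1 := (hTd x).inner ℝ (hTd x)
    simp only [hTT] at h1
    have h2 := h1.unique (hasDerivAt_const x (1 : ℝ))
    linarith [real_inner_comm (deriv C x) (deriv (deriv C) x)]
  have hT'd : ∀ x, ⟪deriv (deriv C) x, d⟫ = 0 := fun x => by
    have h1 := (hTd x).inner ℝ (hasDerivAt_const x d)
    simp only [fun y => hhelix y 0, inner_zero_right, zero_add] at h1
    exact h1.unique (hasDerivAt_const x _)
  have hnn : ∀ x, ⟪n x, n x⟫ = 1 := fun x => by
    rw [real_inner_self_eq_norm_sq, hn, norm_smul, ← hκ, norm_inv, Real.norm_of_nonneg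
      (hκpos x).le, inv_mul_cancel₀ (hκpos x).ne', one_pow]
  have hTn : ∀ x, ⟪deriv C x, n x⟫ = 0 := fun x => by
    rw [hn, inner_smul_right, hT'T, mul_zero]
  have hnd : ∀ x, ⟪n x, d⟫ = 0 := fun x => by
    rw [hn, real_inner_smul_left, hT'd, mul_zero]
  have hncont : Continuous n := by
    rw [funext hn, funext hκ]
    exact (hT'.norm.inv₀ fun x => by rw [← hκ]; exact (hκpos x).ne').smul hT'
  have hbcont : Continuous fun x => ⟪b x, d⟫ := by
    rw [funext hb]
    exact (continuous_cross3 hT.continuous hncont).inner continuous_const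
  have hbsq : ∀ x, ⟪b x, d⟫ ^ 2 = 1 - ⟪deriv C 0, d⟫ ^ 2 := fun x => by
    rw [hb, inner_cross3_sq, hTT, hnn, hTn, hnd, hhelix x 0, real_inner_self_eq_norm_sq, hd]
    ring
  have hcos : Real.cos ((2 * (k : ℝ) + 1) * Real.pi / 2) = 0 :=
    Real.cos_eq_zero_iff.mpr ⟨k, rfl⟩
  simp only [hK, hcos, add_sub_cancel_left, zero_smul, zero_add, real_inner_smul_left,
    hbcont.eq_of_sq_eq_const hbsq s t]
end
end
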